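/- Let f : ℝⁿ → ℝ be C¹ and strictly convex with unique global minimizer ȳ, φ : ℝⁿ → ℝ C², strictly convex, Legendre type, with conjugate φ*; set x̄ := ∇φ(ȳ), V(x) := D_{φ*}(x, x̄), q(x, u) := f(∇φ*(x)) + f*(−u) + ⟨u, ȳ⟩. Let u : [0, ∞) → ℝⁿ be a stabilizing control at x₀, i.e., locally integrable with the trajectory x(t) of ẋ = u, x(0) = x₀ defined for all t ≥ 0 and x(t) → x̄ as t → ∞. Then the infinite-horizon cost satisfies ∫₀^∞ q(x(t), u(t)) dt ≥ V(x₀) (the integral interpreted as the liminf of ∫₀ᵗ q as t → ∞). -/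

import Mathlib

open scoped RealInnerProductSpace
open Filter MeasureTheory

/-- Legendre–Fenchel conjugate: `ψ*(v) = sup_x { ⟨v, x⟩ − ψ(x) }`. -/
noncomputable def fenchel {n : ℕ} (ψ : EuclideanSpace ℝ (Fin n) → ℝ)
    (v : EuclideanSpace ℝ (Fin n)) : ℝ :=
  ⨆ z : EuclideanSpace ℝ (Fin n), (⟪v, z⟫ - ψ z)

/-- Bregman divergence: `D_ψ(y, y') = ψ(y) − ψ(y') − ⟨∇ψ(y'), y − y'⟩`. -/
noncomputable def bregman {n : ℕ} (ψ : EuclideanSpace ℝ (Fin n) → ℝ)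
    (y y' : EuclideanSpace ℝ (Fin n)) : ℝ :=
  ψ y - ψ y' - ⟪gradient ψ y', y - y'⟫

/-- `φ` is of Legendre type: `|∇φ(x)| → ∞` as `|x| → ∞`. -/
def LegendreType {n : ℕ} (φ : EuclideanSpace ℝ (Fin n) → ℝ) : Prop :=
  Tendsto (fun z => ‖gradient φ z‖) (cocompact (EuclideanSpace ℝ (Fin n))) atTop

section Convex

variable {F : Type*} [NormedAddCommGroup F] [InnerProductSpace ℝ F] [CompleteSpace F]

theorem ConvexOn.add_inner_gradient_le {φ : F → ℝ} (hφ : ConvexOn ℝ Set.univ φ) {z : F}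
    (hz : DifferentiableAt ℝ φ z) (w : F) : φ z + ⟪gradient φ z, w - z⟫ ≤ φ w := by
  have hconv : ConvexOn ℝ Set.univ (φ ∘ AffineMap.lineMap (k := ℝ) z w) :=
    hφ.comp_affineMap (AffineMap.lineMap z w)
  have hline : HasDerivAt (AffineMap.lineMap (k := ℝ) z w) (w - z) 0 :=
    AffineMap.hasDerivAt_lineMap
  have hderiv : HasDerivAt (φ ∘ AffineMap.lineMap (k := ℝ) z w) ⟪gradient φ z, w - z⟫ 0 := by
    rw [inner_gradient_left]
    refine HasFDerivAt.comp_hasDerivAt (l := φ) (l' := fderiv ℝ φ z) 0 ?_ hline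
    simpa using hz.hasFDerivAt
  have := hconv.le_slope_of_hasDerivAt (Set.mem_univ 0) (Set.mem_univ 1) one_pos hderiv
  simp only [slope_def_field, Function.comp_apply, AffineMap.lineMap_apply_one,
    AffineMap.lineMap_apply_zero, sub_zero, div_one] at this
  linarith

theorem StrictConvexOn.gradient_injective {φ : F → ℝ} (hφ : StrictConvexOn ℝ Set.univ φ)
    (hd : Differentiable ℝ φ) : Function.Injective (gradient φ) := by
  intro z w hzw
  by_contra hne
  have hlt := hφ.2 (Set.mem_univ z) (Set.mem_univ w) hne (one_half_pos (α := ℝ))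
    one_half_pos (add_halves 1)
  have hz := hφ.convexOn.add_inner_gradient_le (hd z) ((1 / 2 : ℝ) • z + (1 / 2 : ℝ) • w)
  have hw := hφ.convexOn.add_inner_gradient_le (hd w) ((1 / 2 : ℝ) • z + (1 / 2 : ℝ) • w)
  rw [hzw] at hz
  simp only [inner_sub_right, inner_add_right, inner_smul_right, smul_eq_mul] at hz hw hlt
  linarith

theorem ConvexOn.exists_gradient_sub_eq_neg_smul [FiniteDimensional ℝ F] {φ : F → ℝ}
    (hφ : ConvexOn ℝ Set.univ φ) (hd : Differentiable ℝ φ) (v : F) {ε : ℝ} (hε : 0 < ε) :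
    ∃ z, gradient φ z - v = -ε • z ∧ ‖gradient φ z - v‖ ≤ 2 * ‖gradient φ 0 - v‖ := by
  set g := gradient φ 0 - v with hg
  set h : F → ℝ := fun z => φ z - ⟪v, z⟫ + ε / 2 * ‖z‖ ^ 2 with hh
  have hlow (z : F) : h 0 + (ε / 2 * ‖z‖ - ‖g‖) * ‖z‖ ≤ h z := by
    have h1 := hφ.add_inner_gradient_le (hd 0) z
    have h2 : -(‖g‖ * ‖z‖) ≤ ⟪g, z⟫ := (abs_le.mp (abs_real_inner_le_norm g z)).1
    simp only [hg, hh, inner_sub_left, sub_zero, inner_zero_right, norm_zero] at h1 h2 ⊢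
    nlinarith
  have hcont : Continuous h := by
    have := hd.continuous
    fun_prop
  have hcoer : ∀ᶠ z in cocompact F, h 0 ≤ h z := by
    filter_upwards [tendsto_norm_cocompact_atTop.eventually_ge_atTop (2 * ‖g‖ / ε)] with z hz
    rw [div_le_iff₀ hε] at hz
    have : 0 ≤ (ε / 2 * ‖z‖ - ‖g‖) * ‖z‖ := mul_nonneg (by linarith) (norm_nonneg z)
    linarith [hlow z]
  obtain ⟨z, hz⟩ := hcont.exists_forall_le' 0 hcoer
  have hcrit : gradient φ z - v = -ε • z := by
    have hfd : HasFDerivAt h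
        (fderiv ℝ φ z - innerSL ℝ v + (ε / 2) • (2 • innerSL ℝ z)) z :=
      ((hd z).hasFDerivAt.sub (innerSL ℝ v).hasFDerivAt).add
        ((hasStrictFDerivAt_norm_sq z).hasFDerivAt.const_mul (ε / 2))
    have hzero := IsLocalMin.hasFDerivAt_eq_zero (Eventually.of_forall hz) hfd
    refine ext_inner_right ℝ fun w => ?_
    have := congrArg (fun L => L w) hzero
    simp only [add_apply, sub_apply,
      smul_apply, innerSL_apply_apply, zero_apply,
      smul_eq_mul, nsmul_eq_mul, Nat.cast_ofNat] at this
    rw [inner_sub_left, inner_gradient_left, inner_smul_left]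
    simp only [map_neg, conj_trivial]
    linarith
  refine ⟨z, hcrit, ?_⟩
  rw [hcrit, norm_smul, norm_neg, Real.norm_of_nonneg hε.le]
  rcases (norm_nonneg z).eq_or_lt with h0 | h0
  · rw [← h0]
    simp
  · have : (ε / 2 * ‖z‖ - ‖g‖) * ‖z‖ ≤ 0 := by linarith [hlow z, hz 0]
    have := nonpos_of_mul_nonpos_left this h0
    linarith

theorem ConvexOn.gradient_surjective [FiniteDimensional ℝ F] {φ : F → ℝ}
    (hφ : ConvexOn ℝ Set.univ φ) (hd : Differentiable ℝ φ) (hp : IsProperMap (gradient φ)) :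
    Function.Surjective (gradient φ) := by
  intro v
  change v ∈ Set.range (gradient φ)
  rw [← hp.isClosed_range.closure_eq, Metric.mem_closure_iff]
  intro δ hδ
  obtain ⟨R, hR⟩ := (hp.isCompact_preimage
    (isCompact_closedBall v (2 * ‖gradient φ 0 - v‖))).isBounded.subset_closedBall 0
  have hR' : 0 < |R| + 1 := by positivity
  obtain ⟨z, hz, hzv⟩ := hφ.exists_gradient_sub_eq_neg_smul hd v (div_pos hδ hR')
  have hzR : ‖z‖ ≤ R := by
    simpa using hR (show z ∈ gradient φ ⁻¹' Metric.closedBall v _ by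
      simpa [dist_eq_norm] using hzv)
  refine ⟨gradient φ z, ⟨z, rfl⟩, ?_⟩
  rw [dist_comm, dist_eq_norm, hz, norm_smul, norm_neg, Real.norm_of_nonneg (by positivity),
    div_mul_eq_mul_div, div_lt_iff₀ hR']
  gcongr
  linarith [le_abs_self R]

theorem contDiff_one_of_hasGradientAt {W : F → ℝ} {W' : F → F}
    (hW : ∀ v, HasGradientAt W (W' v) v) (hW' : Continuous W') : ContDiff ℝ 1 W := by
  refine contDiff_one_iff_fderiv.2 ⟨fun v => (hW v).differentiableAt, ?_⟩
  rw [← toDual_comp_gradient, gradient_eq hW]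
  exact (InnerProductSpace.toDual ℝ F).continuous.comp hW'

theorem ContDiff.continuous_gradient {φ : F → ℝ} (hφ : ContDiff ℝ 1 φ) :
    Continuous (gradient φ) :=
  (InnerProductSpace.toDual ℝ F).symm.continuous.comp (hφ.continuous_fderiv one_ne_zero)

end Convex

section Fenchel

variable {n : ℕ} {φ : EuclideanSpace ℝ (Fin n) → ℝ}

theorem LegendreType.isProperMap_gradient (hleg : LegendreType φ) (hφ : ContDiff ℝ 1 φ) :
    IsProperMap (gradient φ) := by
  refine isProperMap_iff_tendsto_cocompact.2 ⟨hφ.continuous_gradient, ?_⟩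
  rw [← Metric.cobounded_eq_cocompact (α := EuclideanSpace ℝ (Fin n)),
    ← tendsto_norm_atTop_iff_cobounded, Metric.cobounded_eq_cocompact]
  exact hleg

theorem LegendreType.isHomeomorph_gradient (hleg : LegendreType φ) (hφ : ContDiff ℝ 1 φ)
    (hconv : StrictConvexOn ℝ Set.univ φ) : IsHomeomorph (gradient φ) := by
  have hd := hφ.differentiable one_ne_zero
  have hp := hleg.isProperMap_gradient hφ
  exact isHomeomorph_iff_continuous_isClosedMap_bijective.2 ⟨hp.continuous, hp.isClosedMap,
    hconv.gradient_injective hd, hconv.convexOn.gradient_surjective hd hp⟩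

theorem inner_sub_le_fenchel {v : EuclideanSpace ℝ (Fin n)}
    (hv : BddAbove (Set.range fun z => ⟪v, z⟫ - φ z)) (z : EuclideanSpace ℝ (Fin n)) :
    ⟪v, z⟫ - φ z ≤ fenchel φ v :=
  le_ciSup hv z

theorem inner_gradient_sub_le (hconv : ConvexOn ℝ Set.univ φ) (hd : Differentiable ℝ φ)
    (z w : EuclideanSpace ℝ (Fin n)) :
    ⟪gradient φ z, w⟫ - φ w ≤ ⟪gradient φ z, z⟫ - φ z := by
  have := hconv.add_inner_gradient_le (hd z) w
  rw [inner_sub_right] at this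
  linarith

theorem bddAbove_range_inner_gradient_sub (hconv : ConvexOn ℝ Set.univ φ)
    (hd : Differentiable ℝ φ) (z : EuclideanSpace ℝ (Fin n)) :
    BddAbove (Set.range fun w => ⟪gradient φ z, w⟫ - φ w) :=
  ⟨_, Set.forall_mem_range.2 (inner_gradient_sub_le hconv hd z)⟩

theorem fenchel_gradient (hconv : ConvexOn ℝ Set.univ φ) (hd : Differentiable ℝ φ)
    (z : EuclideanSpace ℝ (Fin n)) :
    fenchel φ (gradient φ z) = ⟪gradient φ z, z⟫ - φ z :=
  le_antisymm (ciSup_le (inner_gradient_sub_le hconv hd z))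
    (inner_sub_le_fenchel (bddAbove_range_inner_gradient_sub hconv hd z) z)

theorem hasGradientAt_fenchel (hconv : ConvexOn ℝ Set.univ φ) (hd : Differentiable ℝ φ)
    {S : EuclideanSpace ℝ (Fin n) → EuclideanSpace ℝ (Fin n)} (hS : Continuous S)
    (hSg : ∀ v, gradient φ (S v) = v) (v : EuclideanSpace ℝ (Fin n)) :
    HasGradientAt (fenchel φ) (S v) v := by
  have hval (w) : fenchel φ w = ⟪w, S w⟫ - φ (S w) := by
    simpa [hSg] using fenchel_gradient hconv hd (S w)
  have hle (w z) : ⟪w, z⟫ - φ z ≤ fenchel φ w := by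
    simpa [hSg] using inner_sub_le_fenchel (bddAbove_range_inner_gradient_sub hconv hd (S w)) z
  rw [hasGradientAt_iff_isLittleO, Asymptotics.isLittleO_iff]
  intro c hc
  have hclose : ∀ᶠ w in nhds v, ‖S w - S v‖ < c := by
    simpa [dist_eq_norm] using (Metric.tendsto_nhds.1 hS.continuousAt c hc)
  filter_upwards [hclose] with w hw
  have h1 := hle w (S v)
  have h2 := hle v (S w)
  rw [hval v] at h2 ⊢
  rw [hval w] at h1 ⊢
  have h3 : ⟪w - v, S w - S v⟫ ≤ ‖w - v‖ * ‖S w - S v‖ := real_inner_le_norm _ _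
  have h4 : ‖w - v‖ * ‖S w - S v‖ ≤ c * ‖w - v‖ := by
    rw [mul_comm]
    gcongr
  rw [real_inner_comm (w - v) (S v), Real.norm_eq_abs, abs_le]
  simp only [inner_sub_left, inner_sub_right] at h3 ⊢
  constructor <;> linarith [mul_nonneg hc.le (norm_nonneg (w - v))]

end Fenchel

section ChainRule

theorem AbsolutelyContinuousOnInterval.of_dist_le_mul {X Y : Type*} [PseudoMetricSpace X]
    [PseudoMetricSpace Y] {f : ℝ → X} {g : ℝ → Y} {a b K : ℝ}
    (hf : AbsolutelyContinuousOnInterval f a b)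
    (hfg : ∀ s ∈ Set.uIcc a b, ∀ t ∈ Set.uIcc a b, dist (g s) (g t) ≤ K * dist (f s) (f t)) :
    AbsolutelyContinuousOnInterval g a b := by
  refine squeeze_zero' (Eventually.of_forall fun E => Finset.sum_nonneg fun _ _ => dist_nonneg) ?_
    (by simpa using Tendsto.const_mul K hf)
  refine eventually_inf_principal.2 (Eventually.of_forall fun E hE => ?_)
  rw [Finset.mul_sum]
  exact Finset.sum_le_sum fun i hi => hfg _ (hE.1 i hi).1 _ (hE.1 i hi).2

variable {F : Type*} [NormedAddCommGroup F] [InnerProductSpace ℝ F]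
  {u : ℝ → F} {a b : ℝ}

theorem IntervalIntegrable.absolutelyContinuousOnInterval_comp_integral {W : F → ℝ}
    (hW : ContDiff ℝ 1 W) (hu : IntervalIntegrable u volume a b) (c : F) :
    AbsolutelyContinuousOnInterval (fun t => W (c + ∫ s in a..t, u s)) a b := by
  have hsub {s : ℝ} (hs : s ∈ Set.uIcc a b) : IntervalIntegrable u volume a s :=
    hu.mono_set (Set.uIcc_subset_uIcc_left hs)
  have hcont : ContinuousOn (fun t => c + ∫ s in a..t, u s) (Set.uIcc a b) :=
    continuousOn_const.add
      (intervalIntegral.continuousOn_primitive_interval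
        ((intervalIntegrable_iff' (by finiteness)).1 hu))
  obtain ⟨K, hK⟩ := hW.locallyLipschitz.locallyLipschitzOn.exists_lipschitzOnWith_of_compact
    (isCompact_uIcc.image_of_continuousOn hcont)
  refine (hu.norm.absolutelyContinuousOnInterval_intervalIntegral
    Set.left_mem_uIcc).of_dist_le_mul (K := K) fun s hs t ht => ?_
  refine (hK.dist_le_mul _ ⟨s, hs, rfl⟩ _ ⟨t, ht, rfl⟩).trans ?_
  gcongr
  rw [dist_add_left, dist_eq_norm, Real.dist_eq,
    intervalIntegral.integral_interval_sub_left (hsub hs) (hsub ht),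
    intervalIntegral.integral_interval_sub_left (hsub hs).norm (hsub ht).norm]
  exact intervalIntegral.norm_integral_le_abs_integral_norm

variable [CompleteSpace F]

theorem IntervalIntegrable.ae_hasDerivAt_comp_integral {W : F → ℝ} (hW : Differentiable ℝ W)
    (hu : IntervalIntegrable u volume a b) (c : F) :
    ∀ᵐ t, t ∈ Set.uIcc a b → HasDerivAt (fun t => W (c + ∫ s in a..t, u s))
      ⟪gradient W (c + ∫ s in a..t, u s), u t⟫ t := by
  filter_upwards [hu.ae_hasDerivAt_integral] with t ht hmem
  rw [inner_gradient_left]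
  exact (hW _).hasFDerivAt.comp_hasDerivAt t ((ht hmem a Set.left_mem_uIcc).const_add c)

theorem sub_le_integral_of_neg_inner_gradient_le {W : F → ℝ} (hW : ContDiff ℝ 1 W)
    (hab : a ≤ b) (hu : IntervalIntegrable u volume a b) {c : F} {x : ℝ → F}
    (hx : ∀ t ∈ Set.Icc a b, x t = c + ∫ s in a..t, u s) {r : ℝ → ℝ}
    (hr : IntervalIntegrable r volume a b)
    (hle : ∀ t ∈ Set.Icc a b, -⟪gradient W (x t), u t⟫ ≤ r t) :
    W (x a) - W (x b) ≤ ∫ t in a..b, r t := by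
  have hac := hu.absolutelyContinuousOnInterval_comp_integral hW c
  have hftc := hac.integral_deriv_eq_sub
  have hmono := intervalIntegral.integral_mono_ae_restrict hab hac.intervalIntegrable_deriv.neg hr
    (by
      refine (ae_restrict_iff' measurableSet_Icc).2 ?_
      filter_upwards [hu.ae_hasDerivAt_comp_integral (hW.differentiable one_ne_zero) c]
        with t ht hmem
      rw [Pi.neg_apply, (ht (Set.Icc_subset_uIcc hmem)).deriv, ← hx t hmem]
      exact hle t hmem)
  simp only [Pi.neg_apply, intervalIntegral.integral_neg, hftc] at hmono
  rw [hx a (Set.left_mem_Icc.2 hab), hx b (Set.right_mem_Icc.2 hab)]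
  linarith

end ChainRule

/-- for any stabilizing control `u` at `x₀` (trajectory
`x(t) = x₀ + ∫₀ᵗ u` defined for all `t ≥ 0` with `x(t) → x̄`), the infinite-horizon
cost, interpreted as the liminf of `∫₀ᵗ q` as `t → ∞` (in the extended reals),
is at least `V(x₀)`. -/
theorem stabilizing_cost_lower_bound {n : ℕ} (f φ : EuclideanSpace ℝ (Fin n) → ℝ)
    (hf : ContDiff ℝ 1 f) (hfconv : StrictConvexOn ℝ Set.univ f)
    (ybar : EuclideanSpace ℝ (Fin n)) (hmin : ∀ z, f ybar ≤ f z)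
    (hfstar : ∀ v : EuclideanSpace ℝ (Fin n),
      BddAbove (Set.range fun z => ⟪v, z⟫ - f z))
    (hφ : ContDiff ℝ 2 φ) (hφconv : StrictConvexOn ℝ Set.univ φ)
    (hleg : LegendreType φ)
    (xbar : EuclideanSpace ℝ (Fin n)) (hxbar : xbar = gradient φ ybar)
    (V : EuclideanSpace ℝ (Fin n) → ℝ)
    (hV : V = fun x => bregman (fenchel φ) x xbar)
    (q : EuclideanSpace ℝ (Fin n) → EuclideanSpace ℝ (Fin n) → ℝ)
    (hq : q = fun x u => f (gradient (fenchel φ) x) + fenchel f (-u) + ⟪u, ybar⟫)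
    (x₀ : EuclideanSpace ℝ (Fin n)) (u x : ℝ → EuclideanSpace ℝ (Fin n))
    (hu : ∀ t : ℝ, IntervalIntegrable u volume 0 t)
    (hx : ∀ t : ℝ, 0 ≤ t → x t = x₀ + ∫ s in (0:ℝ)..t, u s)
    (hqint : ∀ t : ℝ, IntervalIntegrable (fun s => q (x s) (u s)) volume 0 t)
    (hstab : Tendsto x atTop (nhds xbar)) :
    (V x₀ : EReal) ≤
      liminf (fun t : ℝ => ((∫ s in (0:ℝ)..t, q (x s) (u s) : ℝ) : EReal)) atTop := by
  have hφ1 : ContDiff ℝ 1 φ := hφ.of_le one_le_two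
  have hd : Differentiable ℝ φ := hφ1.differentiable one_ne_zero
  set e := (hleg.isHomeomorph_gradient hφ1 hφconv).homeomorph (gradient φ)
  have heg (v) : gradient φ (e.symm v) = v := e.apply_symm_apply v
  have hgrad (v) : HasGradientAt (fenchel φ) (e.symm v) v :=
    hasGradientAt_fenchel hφconv.convexOn hd e.symm.continuous heg v
  have hybar : e.symm xbar = ybar := e.symm_apply_eq.2 hxbar
  have hVgrad (v) : HasGradientAt V (e.symm v - ybar) v := by
    rw [hasGradientAt_iff_hasFDerivAt, map_sub, hV]
    unfold bregman
    rw [(hgrad xbar).gradient, hybar]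
    exact ((hgrad v).hasFDerivAt.sub_const _).sub
      ((InnerProductSpace.toDual ℝ _ ybar).hasFDerivAt.comp v ((hasFDerivAt_id v).sub_const xbar))
  have hVC1 : ContDiff ℝ 1 V :=
    contDiff_one_of_hasGradientAt hVgrad (e.symm.continuous.sub continuous_const)
  have hx0 : x 0 = x₀ := by simp [hx 0 le_rfl]
  have hbound (t : ℝ) (ht : 0 ≤ t) : V x₀ - V (x t) ≤ ∫ s in (0:ℝ)..t, q (x s) (u s) := by
    rw [← hx0]
    refine sub_le_integral_of_neg_inner_gradient_le hVC1 ht (hu t) (fun s hs => hx s hs.1)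
      (hqint t) fun s _ => ?_
    have := inner_sub_le_fenchel (hfstar (-u s)) (e.symm (x s))
    rw [hq, (hVgrad (x s)).gradient]
    simp only [(hgrad (x s)).gradient, inner_sub_left, inner_neg_left] at this ⊢
    rw [real_inner_comm (u s) (e.symm (x s)), real_inner_comm (u s) ybar]
    linarith
  have hVbar : V xbar = 0 := by simp [hV, bregman]
  have hlim : Tendsto (fun t => ((V x₀ - V (x t) : ℝ) : EReal)) atTop (nhds (V x₀ : EReal)) := by
    refine (continuous_coe_real_ereal.tendsto _).comp ?_
    simpa [hVbar] using ((hVC1.continuous.tendsto xbar).comp hstab).const_sub (V x₀)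
  rw [← hlim.liminf_eq]
  refine liminf_le_liminf ?_
  filter_upwards [eventually_ge_atTop 0] with t ht
  exact EReal.coe_le_coe_iff.2 (hbound t ht)
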